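/- arXiv:1008.3560 — 13 statements merged into one kernel-verified Lean document; each statement's English description precedes it below -/
import Mathlib

section
/- In the Tracy–Widom setting, fix indices j ≠ l. Suppose q_j, q_l, p_j, p_l are C¹ and T is C², and that equations (TW1) ∂_l q_j = (−1)^l R_{jl} q_l, ∂_l p_j = (−1)^l R_{jl} p_l, ∂_j q_l = (−1)^j R_{lj} q_j, ∂_j p_l = (−1)^j R_{lj} p_j hold, together with (TW3) for index j: (−1)^{j−1} ∂_j T = p_j ∂_j q_j − q_j ∂_j p_j. Then at every point of Ω the fundamental relation ∂_l ∂_j T = −(−1)^{j+l} R_{jl}² holds. -/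
noncomputable section

/-- Partial derivative in the `j`-th coordinate direction. -/
def pd {N : ℕ} (j : Fin N) (f : (Fin N → ℝ) → ℝ) : (Fin N → ℝ) → ℝ :=
  fun x => fderiv ℝ f x (Pi.single j 1)

/-- Virasoro-type operator `𝓑_k` (meaningful for `k ≥ -1`):
`𝓑_k f = Σ_j a_j^(k+1) ∂_j f`. -/
def Bop {N : ℕ} (k : ℤ) (f : (Fin N → ℝ) → ℝ) : (Fin N → ℝ) → ℝ :=
  fun x => ∑ j, (x j) ^ (k + 1).toNat * pd j f x

/-- `𝓓 = 𝓑_{-1} = Σ_j ∂_j`. -/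
def Dop {N : ℕ} (f : (Fin N → ℝ) → ℝ) : (Fin N → ℝ) → ℝ := Bop (-1) f

/-- `Ĝ_k = Σ_j a_j^k G_j` (meaningful for `k ≥ 0`). -/
def hatG {N : ℕ} (k : ℤ) (G : Fin N → (Fin N → ℝ) → ℝ) : (Fin N → ℝ) → ℝ :=
  fun x => ∑ j, (x j) ^ k.toNat * G j x

/-- The Tracy–Widom resolvent quantity `R_{jk} = (q_j p_k - p_j q_k)/(a_j - a_k)`. -/
def Rjk {N : ℕ} (q p : Fin N → (Fin N → ℝ) → ℝ) (j k : Fin N) : (Fin N → ℝ) → ℝ :=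
  fun x => (q j x * p k x - p j x * q k x) / (x j - x k)



open Filter Topology

theorem schwarz_aux (f g k : ℝ → ℝ → ℝ) (m : ℝ → ℝ)
    (h1 : ∀ᶠ z : ℝ × ℝ in 𝓝 (0, 0), HasDerivAt (fun t => f z.1 t) (g z.1 z.2) z.2)
    (h2 : ∀ᶠ z : ℝ × ℝ in 𝓝 (0, 0), HasDerivAt (fun s => g s z.2) (k z.1 z.2) z.1)
    (h3 : ∀ᶠ t : ℝ in 𝓝 0, HasDerivAt (fun s => f s t) (m t) 0)
    (hk : Tendsto (fun z : ℝ × ℝ => k z.1 z.2) (𝓝 (0, 0)) (𝓝 (k 0 0))) :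
    HasDerivAt m (k 0 0) 0 := by
  rw [hasDerivAt_iff_isLittleO, Asymptotics.isLittleO_iff]
  intro ε hε
  have h4 : ∀ᶠ z : ℝ × ℝ in 𝓝 (0, 0), ‖k z.1 z.2 - k 0 0‖ ≤ ε := by
    filter_upwards [hk.eventually (Metric.closedBall_mem_nhds _ hε)] with z hz
    simpa [dist_eq_norm] using hz
  obtain ⟨δ, hδ, H⟩ := Metric.eventually_nhds_iff.1 (h1.and (h2.and h4))
  have H' : ∀ s ∈ Metric.ball (0:ℝ) δ, ∀ t ∈ Metric.ball (0:ℝ) δ,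
      HasDerivAt (fun t => f s t) (g s t) t ∧ HasDerivAt (fun s => g s t) (k s t) s ∧
      ‖k s t - k 0 0‖ ≤ ε := by
    intro s hs t ht
    exact H (y := (s, t)) (by rw [Prod.dist_eq]; exact max_lt hs ht)
  have m0 : (0:ℝ) ∈ Metric.ball (0:ℝ) δ := Metric.mem_ball_self hδ
  have hg : ∀ s ∈ Metric.ball (0:ℝ) δ, ∀ t ∈ Metric.ball (0:ℝ) δ,
      ‖g s t - g 0 t - s * k 0 0‖ ≤ ε * ‖s‖ := by
    intro s hs t ht
    have := (convex_ball (0:ℝ) δ).norm_image_sub_le_of_norm_hasDerivWithin_le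
      (f := fun s => g s t - s * k 0 0) (f' := fun s => k s t - 1 * k 0 0) (C := ε)
      (fun s hs => (((H' s hs t ht).2.1).sub
        ((hasDerivAt_id s).mul_const (k 0 0))).hasDerivWithinAt)
      (fun s hs => by simpa using (H' s hs t ht).2.2) m0 hs
    have e : g s t - g 0 t - s * k 0 0 = g s t - s * k 0 0 - (g 0 t - 0 * k 0 0) := by ring
    rw [e]; simpa using this
  have hf : ∀ s ∈ Metric.ball (0:ℝ) δ, ∀ t ∈ Metric.ball (0:ℝ) δ,
      ‖(f s t - f s 0 - s * (t * k 0 0)) - (f 0 t - f 0 0)‖ ≤ ε * ‖s‖ * ‖t‖ := by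
    intro s hs t ht
    have := (convex_ball (0:ℝ) δ).norm_image_sub_le_of_norm_hasDerivWithin_le
      (f := fun t => f s t - f 0 t - t * (s * k 0 0))
      (f' := fun t => g s t - g 0 t - 1 * (s * k 0 0)) (C := ε * ‖s‖)
      (fun t ht => (((H' s hs t ht).1.sub (H' 0 m0 t ht).1).sub
        ((hasDerivAt_id t).mul_const (s * k 0 0))).hasDerivWithinAt)
      (fun t ht => by simpa using hg s hs t ht) m0 ht
    have e : (f s t - f s 0 - s * (t * k 0 0)) - (f 0 t - f 0 0)
      = f s t - f 0 t - t * (s * k 0 0) - (f s 0 - f 0 0 - 0 * (s * k 0 0)) := by ring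
    rw [e]; simpa using this
  have h30 := h3.self_of_nhds
  filter_upwards [h3, Metric.ball_mem_nhds (0:ℝ) hδ] with t h3t ht
  have hd : HasDerivAt (fun s => f s t - f s 0 - s * (t * k 0 0))
      (m t - m 0 - 1 * (t * k 0 0)) 0 :=
    (h3t.sub h30).sub ((hasDerivAt_id (0:ℝ)).mul_const (t * k 0 0))
  have := hd.le_of_lip' (C := ε * ‖t‖) (by positivity) (by
    filter_upwards [Metric.ball_mem_nhds (0:ℝ) hδ] with s hs
    have := hf s hs t ht
    simp only [sub_zero, zero_mul]
    calc _ ≤ _ := this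
      _ = _ := by ring)
  simpa using this

theorem pd_line {N : ℕ} (i : Fin N) {f : (Fin N → ℝ) → ℝ} (y : Fin N → ℝ) (t : ℝ)
    (hf : DifferentiableAt ℝ f (y + t • Pi.single i 1)) :
    HasDerivAt (fun t : ℝ => f (y + t • Pi.single i 1)) (pd i f (y + t • Pi.single i 1)) t := by
  have h : HasDerivAt (fun t : ℝ => y + t • (Pi.single i 1 : Fin N → ℝ)) (Pi.single i 1) t := by
    simpa using ((hasDerivAt_id t).smul_const (Pi.single i 1 : Fin N → ℝ)).const_add y
  exact hf.hasFDerivAt.comp_hasDerivAt t h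

theorem pd_line0 {N : ℕ} (i : Fin N) {f : (Fin N → ℝ) → ℝ} (y : Fin N → ℝ)
    (hf : DifferentiableAt ℝ f y) :
    HasDerivAt (fun t : ℝ => f (y + t • Pi.single i 1)) (pd i f y) 0 := by
  have := pd_line i y 0 (f := f) (by simpa using hf)
  simpa using this


theorem schwarz_pd {N : ℕ} (Ω : Set (Fin N → ℝ)) (hΩ : IsOpen Ω) (j l : Fin N)
    (f g : (Fin N → ℝ) → ℝ) (hf : ContDiffOn ℝ 1 f Ω) (hg : ContDiffOn ℝ 1 g Ω)
    (hfg : ∀ x ∈ Ω, pd l f x = g x) (x : Fin N → ℝ) (hx : x ∈ Ω) :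
    HasDerivAt (fun t : ℝ => pd j f (x + t • Pi.single l 1)) (pd j g x) 0 := by
  set a : Fin N → ℝ := Pi.single j 1 with ha
  set b : Fin N → ℝ := Pi.single l 1 with hb
  have hdf : ∀ y ∈ Ω, DifferentiableAt ℝ f y := fun y hy =>
    (hf.contDiffAt (hΩ.mem_nhds hy)).differentiableAt (by simp)
  have hdg : ∀ y ∈ Ω, DifferentiableAt ℝ g y := fun y hy =>
    (hg.contDiffAt (hΩ.mem_nhds hy)).differentiableAt (by simp)
  have hc : Continuous (fun z : ℝ × ℝ => x + z.1 • a + z.2 • b) := by fun_prop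
  have hc0 : Tendsto (fun z : ℝ × ℝ => x + z.1 • a + z.2 • b) (𝓝 (0, 0)) (𝓝 x) := by
    have := hc.tendsto (0, 0)
    simpa using this
  have hev : ∀ᶠ z : ℝ × ℝ in 𝓝 (0, 0), x + z.1 • a + z.2 • b ∈ Ω :=
    hc0.eventually (hΩ.mem_nhds hx)
  have hev1 : ∀ᶠ t : ℝ in 𝓝 0, x + t • b ∈ Ω := by
    have : Tendsto (fun t : ℝ => x + t • b) (𝓝 0) (𝓝 x) := by
      have : Continuous (fun t : ℝ => x + t • b) := by fun_prop
      simpa using this.tendsto 0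
    exact this.eventually (hΩ.mem_nhds hx)
  have key := schwarz_aux (fun s t => f (x + s • a + t • b)) (fun s t => g (x + s • a + t • b))
    (fun s t => pd j g (x + s • a + t • b)) (fun t => pd j f (x + t • b)) ?_ ?_ ?_ ?_
  · simpa using key
  · filter_upwards [hev] with z hz
    rw [← hfg _ hz]
    exact pd_line l (x + z.1 • a) z.2 (hdf _ hz)
  · filter_upwards [hev] with z hz
    have e : ∀ s : ℝ, x + s • a + z.2 • b = (x + z.2 • b) + s • a := fun s => by abel
    simp only [e] at hz ⊢
    exact pd_line j (x + z.2 • b) z.1 (hdg _ hz)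
  · filter_upwards [hev1] with t ht
    have e : ∀ s : ℝ, x + s • a + t • b = (x + t • b) + s • a := fun s => by abel
    simp only [e]
    exact pd_line0 j (x + t • b) (hdf _ ht)
  · have hcg : ContinuousAt (pd j g) x := by
      have h := (hg.continuousOn_fderiv_of_isOpen hΩ (by simp)).continuousAt (hΩ.mem_nhds hx)
      exact h.clm_apply continuousAt_const
    simpa [Function.comp_def] using hcg.tendsto.comp hc0


theorem statement1 {N : ℕ} (hN : 2 ≤ N) (Ω : Set (Fin N → ℝ)) (hΩ : IsOpen Ω)
    (hdist : ∀ x ∈ Ω, ∀ j l : Fin N, j ≠ l → x j ≠ x l)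
    (q p : Fin N → (Fin N → ℝ) → ℝ) (T : (Fin N → ℝ) → ℝ)
    (j l : Fin N) (hjl : j ≠ l)
    (hq : ∀ i, ContDiffOn ℝ 1 (q i) Ω) (hp : ∀ i, ContDiffOn ℝ 1 (p i) Ω)
    (hT : ContDiffOn ℝ 2 T Ω)
    (hTW1a : ∀ x ∈ Ω, pd l (q j) x = (-1 : ℝ) ^ (l : ℕ) * Rjk q p j l x * q l x)
    (hTW1b : ∀ x ∈ Ω, pd l (p j) x = (-1 : ℝ) ^ (l : ℕ) * Rjk q p j l x * p l x)
    (hTW1c : ∀ x ∈ Ω, pd j (q l) x = (-1 : ℝ) ^ (j : ℕ) * Rjk q p l j x * q j x)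
    (hTW1d : ∀ x ∈ Ω, pd j (p l) x = (-1 : ℝ) ^ (j : ℕ) * Rjk q p l j x * p j x)
    (hTW3 : ∀ x ∈ Ω,
      (-1 : ℝ) ^ ((j : ℕ) + 1) * pd j T x = p j x * pd j (q j) x - q j x * pd j (p j) x) :
    ∀ x ∈ Ω, pd l (pd j T) x = -((-1 : ℝ) ^ ((j : ℕ) + (l : ℕ)) * (Rjk q p j l x) ^ 2) := by
  intro x hx
  set b : Fin N → ℝ := Pi.single l 1 with hb
  have hd : ∀ (f : (Fin N → ℝ) → ℝ), ContDiffOn ℝ 1 f Ω → ∀ y ∈ Ω, DifferentiableAt ℝ f y :=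
    fun f hf y hy => (hf.contDiffAt (hΩ.mem_nhds hy)).differentiableAt (by simp)
  have hR : ContDiffOn ℝ 1 (Rjk q p j l) Ω := by
    unfold Rjk
    refine ContDiffOn.div (((hq j).mul (hp l)).sub ((hp j).mul (hq l))) ?_
      (fun y hy => sub_ne_zero.2 (hdist y hy j l hjl))
    exact ContDiff.contDiffOn (by fun_prop)
  have hGq : ContDiffOn ℝ 1 (fun y => (-1 : ℝ) ^ (l : ℕ) * Rjk q p j l y * q l y) Ω :=
    (contDiffOn_const.mul hR).mul (hq l)
  have hGp : ContDiffOn ℝ 1 (fun y => (-1 : ℝ) ^ (l : ℕ) * Rjk q p j l y * p l y) Ω :=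
    (contDiffOn_const.mul hR).mul (hp l)
  have Sq := schwarz_pd Ω hΩ j l _ _ (hq j) hGq hTW1a x hx
  have Sp := schwarz_pd Ω hΩ j l _ _ (hp j) hGp hTW1b x hx
  have Lq := pd_line0 l x (hd _ (hq j) x hx)
  have Lp := pd_line0 l x (hd _ (hp j) x hx)
  have hdT : DifferentiableAt ℝ (pd j T) x := by
    have h2 : ContDiffAt ℝ 2 T x := hT.contDiffAt (hΩ.mem_nhds hx)
    have h3 : ContDiffAt ℝ 1 (fderiv ℝ T) x := h2.fderiv_right (by norm_num)
    exact (h3.differentiableAt (by simp)).clm_apply (differentiableAt_const _)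
  have LT := (pd_line0 l x hdT).const_mul ((-1 : ℝ) ^ ((j : ℕ) + 1))
  have hev1 : ∀ᶠ t : ℝ in 𝓝 0, x + t • b ∈ Ω := by
    have : Tendsto (fun t : ℝ => x + t • b) (𝓝 0) (𝓝 x) := by
      have : Continuous (fun t : ℝ => x + t • b) := by fun_prop
      simpa using this.tendsto 0
    exact this.eventually (hΩ.mem_nhds hx)
  have LR := (Lp.mul Sq).sub (Lq.mul Sp)
  have E := LT.unique (LR.congr_of_eventuallyEq (by
    filter_upwards [hev1] with t ht
    exact hTW3 _ ht))
  simp only [zero_smul, add_zero] at E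
  rw [hTW1a x hx, hTW1b x hx] at E
  -- product rules in direction j
  have Aq := pd_line0 j x (hd _ (hq j) x hx)
  have Ap := pd_line0 j x (hd _ (hp j) x hx)
  have Bq := pd_line0 j x (hd _ (hq l) x hx)
  have Bp := pd_line0 j x (hd _ (hp l) x hx)
  have AR := pd_line0 j x (hd _ hR x hx)
  have Eq := (pd_line0 j x (hd _ hGq x hx)).unique ((AR.const_mul ((-1 : ℝ) ^ (l : ℕ))).mul Bq)
  have Ep := (pd_line0 j x (hd _ hGp x hx)).unique ((AR.const_mul ((-1 : ℝ) ^ (l : ℕ))).mul Bp)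
  have Aj : HasDerivAt (fun t : ℝ => (x + t • (Pi.single j 1 : Fin N → ℝ)) j
      - (x + t • (Pi.single j 1 : Fin N → ℝ)) l) 1 0 := by
    have : (fun t : ℝ => (x + t • (Pi.single j 1 : Fin N → ℝ)) j
      - (x + t • (Pi.single j 1 : Fin N → ℝ)) l) = fun t => t + (x j - x l) := by
      funext t
      simp [hjl.symm]
      ring
    rw [this]
    exact (hasDerivAt_id (0:ℝ)).add_const _
  have hev2 : ∀ᶠ t : ℝ in 𝓝 0, x + t • (Pi.single j 1 : Fin N → ℝ) ∈ Ω := by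
    have : Tendsto (fun t : ℝ => x + t • (Pi.single j 1 : Fin N → ℝ)) (𝓝 0) (𝓝 x) := by
      have : Continuous (fun t : ℝ => x + t • (Pi.single j 1 : Fin N → ℝ)) := by fun_prop
      simpa using this.tendsto 0
    exact this.eventually (hΩ.mem_nhds hx)
  have hDR : ∀ y ∈ Ω, Rjk q p j l y * (y j - y l) = q j y * p l y - p j y * q l y := by
    intro y hy
    exact div_mul_cancel₀ _ (sub_ne_zero.2 (hdist y hy j l hjl))
  have ER := (AR.mul Aj).unique (((Aq.mul Bp).sub (Ap.mul Bq)).congr_of_eventuallyEq (by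
    filter_upwards [hev2] with t ht
    exact hDR _ ht))
  have hD := hDR x hx
  simp only [zero_smul, add_zero] at Eq Ep ER
  rw [hTW1c x hx, hTW1d x hx] at ER
  rw [hTW1c x hx] at Eq
  rw [hTW1d x hx] at Ep
  rw [Eq, Ep] at E
  have hs : (-1 : ℝ) ^ (j : ℕ) * (-1 : ℝ) ^ (j : ℕ) = 1 := by
    rw [← mul_pow]; simp
  rw [pow_succ] at E
  rw [pow_add]
  generalize (-1 : ℝ) ^ (j : ℕ) = ej at *
  generalize (-1 : ℝ) ^ (l : ℕ) = el at *
  generalize Rjk q p j l x = R at *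
  generalize Rjk q p l j x = R' at *
  generalize pd j (Rjk q p j l) x = dR at *
  generalize pd l (pd j T) x = dT at *
  generalize pd j (q j) x = dq at *
  generalize pd j (p j) x = dp at *
  have E2 : -ej * dT = el * R ^ 2 := by
    linear_combination E - el * R * ER + el * dR * hD
  linear_combination (-ej) * E2 - dT * hs
end
end

section
/- In the Tracy–Widom setting, fix indices j ≠ l and suppose equations (TW1) (for the pair j, l in both orders) and (TW2) hold, with q's, p's C¹ and u, v, w C². Then with F = −uw and G_j = u ∂_j w − w ∂_j u, at every point of Ω: G_l ∂_j F − G_j ∂_l F = 2 F (a_j − a_l) ∂_j∂_l v. -/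
noncomputable section

theorem statement3 {N : ℕ} (hN : 2 ≤ N) (Ω : Set (Fin N → ℝ)) (hΩ : IsOpen Ω)
    (hdist : ∀ x ∈ Ω, ∀ j l : Fin N, j ≠ l → x j ≠ x l)
    (u v w : (Fin N → ℝ) → ℝ) (q p : Fin N → (Fin N → ℝ) → ℝ)
    (j l : Fin N) (hjl : j ≠ l)
    (hq : ∀ i, ContDiffOn ℝ 1 (q i) Ω) (hp : ∀ i, ContDiffOn ℝ 1 (p i) Ω)
    (hu : ContDiffOn ℝ 2 u Ω) (hv : ContDiffOn ℝ 2 v Ω) (hw : ContDiffOn ℝ 2 w Ω)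
    (hTW1a : ∀ x ∈ Ω, pd l (q j) x = (-1 : ℝ) ^ (l : ℕ) * Rjk q p j l x * q l x)
    (hTW1b : ∀ x ∈ Ω, pd l (p j) x = (-1 : ℝ) ^ (l : ℕ) * Rjk q p j l x * p l x)
    (hTW1c : ∀ x ∈ Ω, pd j (q l) x = (-1 : ℝ) ^ (j : ℕ) * Rjk q p l j x * q j x)
    (hTW1d : ∀ x ∈ Ω, pd j (p l) x = (-1 : ℝ) ^ (j : ℕ) * Rjk q p l j x * p j x)
    (hTW2u : ∀ (i : Fin N), ∀ x ∈ Ω, pd i u x = (-1 : ℝ) ^ (i : ℕ) * (q i x) ^ 2)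
    (hTW2v : ∀ (i : Fin N), ∀ x ∈ Ω, pd i v x = (-1 : ℝ) ^ (i : ℕ) * (q i x * p i x))
    (hTW2w : ∀ (i : Fin N), ∀ x ∈ Ω, pd i w x = (-1 : ℝ) ^ (i : ℕ) * (p i x) ^ 2)
    (F : (Fin N → ℝ) → ℝ) (hF : ∀ x, F x = -(u x * w x))
    (G : Fin N → (Fin N → ℝ) → ℝ)
    (hG : ∀ i x, G i x = u x * pd i w x - w x * pd i u x) :
    ∀ x ∈ Ω,
      G l x * pd j F x - G j x * pd l F x = 2 * F x * (x j - x l) * pd j (pd l v) x := by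
  intro x hx
  have hnx : Ω ∈ nhds x := hΩ.mem_nhds hx
  have du : DifferentiableAt ℝ u x := (hu.contDiffAt hnx).differentiableAt (by norm_num)
  have dw : DifferentiableAt ℝ w x := (hw.contDiffAt hnx).differentiableAt (by norm_num)
  have dq : DifferentiableAt ℝ (q l) x := ((hq l).contDiffAt hnx).differentiableAt (by norm_num)
  have dp : DifferentiableAt ℝ (p l) x := ((hp l).contDiffAt hnx).differentiableAt (by norm_num)
  have hFd : ∀ i, pd i F x = -(u x * pd i w x + w x * pd i u x) := by
    intro i
    have hF' : F = fun y => -(u y * w y) := funext hF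
    have h := ((du.hasFDerivAt.mul dw.hasFDerivAt).neg).fderiv
    have h2 : fderiv ℝ F x = -(u x • fderiv ℝ w x + w x • fderiv ℝ u x) := by
      rw [hF']; exact h
    simp [pd, h2]
  have hvd : pd j (pd l v) x
      = (-1 : ℝ) ^ (l : ℕ) * (q l x * pd j (p l) x + p l x * pd j (q l) x) := by
    have he : pd l v =ᶠ[nhds x] fun y => (-1 : ℝ) ^ (l : ℕ) * (q l y * p l y) :=
      Filter.eventually_of_mem hnx (fun y hy => hTW2v l y hy)
    have h : fderiv ℝ (fun y => (-1 : ℝ) ^ (l : ℕ) * (q l y * p l y)) x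
        = (-1 : ℝ) ^ (l : ℕ) • (q l x • fderiv ℝ (p l) x + p l x • fderiv ℝ (q l) x) :=
      ((dq.hasFDerivAt.mul dp.hasFDerivAt).const_mul _).fderiv
    have h2 := he.fderiv_eq.trans h
    change fderiv ℝ (pd l v) x (Pi.single j 1) = _
    rw [h2]
    simp [pd, mul_add]
  rw [hvd, hFd, hFd, hG, hG, hF, hTW1c x hx, hTW1d x hx, hTW2u j x hx, hTW2u l x hx,
    hTW2w j x hx, hTW2w l x hx]
  have hR : (x j - x l) * Rjk q p l j x = -(q l x * p j x - p l x * q j x) := by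
    have : x l - x j ≠ 0 := sub_ne_zero.mpr (hdist x hx l j hjl.symm)
    unfold Rjk
    field_simp
    ring
  linear_combination (2 * u x * w x * (-1 : ℝ) ^ (l : ℕ) * (-1 : ℝ) ^ (j : ℕ) *
    (q l x * p j x + p l x * q j x)) * hR
end
end

section
/- In the Tracy–Widom setting, fix indices j ≠ l and suppose equations (TW1) (for the pair j, l in both orders) and (TW2) hold, with q's, p's C¹ and u, v, w C². Then with G_j = u ∂_j w − w ∂_j u, the linear relation ∂_j G_l − ∂_l G_j = 2 (a_j − a_l) ∂_j∂_l v holds at every point of Ω. -/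
noncomputable section

theorem pd_congr_on {N : ℕ} {Ω : Set (Fin N → ℝ)} (hΩ : IsOpen Ω) (i : Fin N)
    {f g : (Fin N → ℝ) → ℝ} (h : ∀ x ∈ Ω, f x = g x) {x : Fin N → ℝ} (hx : x ∈ Ω) :
    pd i f x = pd i g x := by
  have : f =ᶠ[nhds x] g := Filter.eventuallyEq_of_mem (hΩ.mem_nhds hx) h
  simp only [pd, this.fderiv_eq]

theorem pd_mul' {N : ℕ} (i : Fin N) {f g : (Fin N → ℝ) → ℝ} {x : Fin N → ℝ}
    (hf : DifferentiableAt ℝ f x) (hg : DifferentiableAt ℝ g x) :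
    pd i (fun y => f y * g y) x = f x * pd i g x + g x * pd i f x := by
  simp only [pd, fderiv_fun_mul hf hg]
  simp

theorem pd_cmul' {N : ℕ} (i : Fin N) (c : ℝ) {f g : (Fin N → ℝ) → ℝ} {x : Fin N → ℝ}
    (hf : DifferentiableAt ℝ f x) (hg : DifferentiableAt ℝ g x) :
    pd i (fun y => c * (f y * g y)) x = c * (f x * pd i g x + g x * pd i f x) := by
  rw [pd_mul' i (f := fun _ => c) (differentiableAt_const c) (hf.fun_mul hg), pd_mul' i hf hg]
  simp [pd]

theorem pd_G {N : ℕ} (i : Fin N) (c : ℝ) {u w q p : (Fin N → ℝ) → ℝ} {x : Fin N → ℝ}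
    (hu : DifferentiableAt ℝ u x) (hw : DifferentiableAt ℝ w x)
    (hq : DifferentiableAt ℝ q x) (hp : DifferentiableAt ℝ p x) :
    pd i (fun y => u y * (c * (p y * p y)) - w y * (c * (q y * q y))) x =
      u x * (c * (2 * p x * pd i p x)) + c * (p x * p x) * pd i u x
      - (w x * (c * (2 * q x * pd i q x)) + c * (q x * q x) * pd i w x) := by
  have h1 : DifferentiableAt ℝ (fun y => c * (p y * p y)) x := by fun_prop
  have h2 : DifferentiableAt ℝ (fun y => c * (q y * q y)) x := by fun_prop
  have e : pd i (fun y => u y * (c * (p y * p y)) - w y * (c * (q y * q y))) x =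
      pd i (fun y => u y * (c * (p y * p y))) x - pd i (fun y => w y * (c * (q y * q y))) x := by
    simp only [pd, fderiv_fun_sub (hu.fun_mul h1) (hw.fun_mul h2)]
    simp
  rw [e, pd_mul' i hu h1, pd_mul' i hw h2, pd_cmul' i c hp hp, pd_cmul' i c hq hq]
  ring

theorem statement4 {N : ℕ} (hN : 2 ≤ N) (Ω : Set (Fin N → ℝ)) (hΩ : IsOpen Ω)
    (hdist : ∀ x ∈ Ω, ∀ j l : Fin N, j ≠ l → x j ≠ x l)
    (u v w : (Fin N → ℝ) → ℝ) (q p : Fin N → (Fin N → ℝ) → ℝ)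
    (j l : Fin N) (hjl : j ≠ l)
    (hq : ∀ i, ContDiffOn ℝ 1 (q i) Ω) (hp : ∀ i, ContDiffOn ℝ 1 (p i) Ω)
    (hu : ContDiffOn ℝ 2 u Ω) (hv : ContDiffOn ℝ 2 v Ω) (hw : ContDiffOn ℝ 2 w Ω)
    (hTW1a : ∀ x ∈ Ω, pd l (q j) x = (-1 : ℝ) ^ (l : ℕ) * Rjk q p j l x * q l x)
    (hTW1b : ∀ x ∈ Ω, pd l (p j) x = (-1 : ℝ) ^ (l : ℕ) * Rjk q p j l x * p l x)
    (hTW1c : ∀ x ∈ Ω, pd j (q l) x = (-1 : ℝ) ^ (j : ℕ) * Rjk q p l j x * q j x)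
    (hTW1d : ∀ x ∈ Ω, pd j (p l) x = (-1 : ℝ) ^ (j : ℕ) * Rjk q p l j x * p j x)
    (hTW2u : ∀ (i : Fin N), ∀ x ∈ Ω, pd i u x = (-1 : ℝ) ^ (i : ℕ) * (q i x) ^ 2)
    (hTW2v : ∀ (i : Fin N), ∀ x ∈ Ω, pd i v x = (-1 : ℝ) ^ (i : ℕ) * (q i x * p i x))
    (hTW2w : ∀ (i : Fin N), ∀ x ∈ Ω, pd i w x = (-1 : ℝ) ^ (i : ℕ) * (p i x) ^ 2)
    (G : Fin N → (Fin N → ℝ) → ℝ)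
    (hG : ∀ i x, G i x = u x * pd i w x - w x * pd i u x) :
    ∀ x ∈ Ω,
      pd j (G l) x - pd l (G j) x = 2 * (x j - x l) * pd j (pd l v) x := by
  intro x hx
  have hn := hΩ.mem_nhds hx
  have dq : ∀ i, DifferentiableAt ℝ (q i) x := fun i =>
    ((hq i).contDiffAt hn).differentiableAt (by norm_num)
  have dp : ∀ i, DifferentiableAt ℝ (p i) x := fun i =>
    ((hp i).contDiffAt hn).differentiableAt (by norm_num)
  have du : DifferentiableAt ℝ u x := (hu.contDiffAt hn).differentiableAt (by norm_num)
  have dw : DifferentiableAt ℝ w x := (hw.contDiffAt hn).differentiableAt (by norm_num)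
  have hGe : ∀ i, ∀ y ∈ Ω, G i y = u y * ((-1 : ℝ) ^ (i : ℕ) * (p i y * p i y))
      - w y * ((-1 : ℝ) ^ (i : ℕ) * (q i y * q i y)) := by
    intro i y hy
    rw [hG, hTW2u i y hy, hTW2w i y hy]
    ring
  rw [pd_congr_on hΩ j (hGe l) hx, pd_congr_on hΩ l (hGe j) hx,
    pd_congr_on hΩ j (hTW2v l) hx, pd_G j _ du dw (dq l) (dp l), pd_G l _ du dw (dq j) (dp j),
    pd_cmul' j _ (dq l) (dp l), hTW1a x hx, hTW1b x hx, hTW1c x hx, hTW1d x hx,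
    hTW2u j x hx, hTW2u l x hx, hTW2w j x hx, hTW2w l x hx]
  have hd : x j - x l ≠ 0 := sub_ne_zero.mpr (hdist x hx j l hjl)
  have hR : Rjk q p l j x = Rjk q p j l x := by
    simp only [Rjk]
    rw [← neg_sub (x j) (x l), div_neg, ← neg_div]
    congr 1
    ring
  have hm : Rjk q p j l x * (x j - x l) = q j x * p l x - p j x * q l x := by
    simp only [Rjk]
    exact div_mul_cancel₀ _ hd
  rw [hR]
  generalize Rjk q p j l x = R at *
  linear_combination (-2 * (-1 : ℝ) ^ (j : ℕ) * (-1 : ℝ) ^ (l : ℕ) *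
    (q j x * p l x + p j x * q l x)) * hm
end
end

section
/- In the Tracy–Widom setting, fix an index j and suppose equations (TW2) and (TW3) hold for this j, with q_j, p_j C¹ and u, v, w, T C². Then with F = −uw and G_j = u ∂_j w − w ∂_j u, at every point of Ω the one-point equation ∂_j v · ∂_j G_j = G_j ∂_j∂_j v − ∂_j T · ∂_j F holds. -/
noncomputable section

theorem statement5 {N : ℕ} (hN : 2 ≤ N) (Ω : Set (Fin N → ℝ)) (hΩ : IsOpen Ω)
    (hdist : ∀ x ∈ Ω, ∀ j l : Fin N, j ≠ l → x j ≠ x l)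
    (u v w T : (Fin N → ℝ) → ℝ) (q p : Fin N → (Fin N → ℝ) → ℝ)
    (j : Fin N)
    (hq : ContDiffOn ℝ 1 (q j) Ω) (hp : ContDiffOn ℝ 1 (p j) Ω)
    (hu : ContDiffOn ℝ 2 u Ω) (hv : ContDiffOn ℝ 2 v Ω)
    (hw : ContDiffOn ℝ 2 w Ω) (hT : ContDiffOn ℝ 2 T Ω)
    (hTW2u : ∀ x ∈ Ω, pd j u x = (-1 : ℝ) ^ (j : ℕ) * (q j x) ^ 2)
    (hTW2v : ∀ x ∈ Ω, pd j v x = (-1 : ℝ) ^ (j : ℕ) * (q j x * p j x))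
    (hTW2w : ∀ x ∈ Ω, pd j w x = (-1 : ℝ) ^ (j : ℕ) * (p j x) ^ 2)
    (hTW3 : ∀ x ∈ Ω,
      (-1 : ℝ) ^ ((j : ℕ) + 1) * pd j T x = p j x * pd j (q j) x - q j x * pd j (p j) x)
    (F : (Fin N → ℝ) → ℝ) (hF : ∀ x, F x = -(u x * w x))
    (G : Fin N → (Fin N → ℝ) → ℝ)
    (hG : ∀ i x, G i x = u x * pd i w x - w x * pd i u x) :
    ∀ x ∈ Ω,
      pd j v x * pd j (G j) x = G j x * pd j (pd j v) x - pd j T x * pd j F x := by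
  intro x hx
  have hn : Ω ∈ nhds x := hΩ.mem_nhds hx
  have dq : HasFDerivAt (q j) (fderiv ℝ (q j) x) x :=
    ((hq.contDiffAt hn).differentiableAt (by norm_num)).hasFDerivAt
  have dp : HasFDerivAt (p j) (fderiv ℝ (p j) x) x :=
    ((hp.contDiffAt hn).differentiableAt (by norm_num)).hasFDerivAt
  have du : HasFDerivAt u (fderiv ℝ u x) x :=
    ((hu.contDiffAt hn).differentiableAt (by norm_num)).hasFDerivAt
  have dw : HasFDerivAt w (fderiv ℝ w x) x :=
    ((hw.contDiffAt hn).differentiableAt (by norm_num)).hasFDerivAt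
  have eu := hTW2u x hx
  have ev := hTW2v x hx
  have ew := hTW2w x hx
  have eT := hTW3 x hx
  have hs : ((-1 : ℝ) ^ (j : ℕ)) * ((-1 : ℝ) ^ (j : ℕ)) = 1 := by
    rw [← mul_pow]; norm_num
  rw [pow_succ] at eT
  have eGx : G j x = u x * ((-1 : ℝ) ^ (j : ℕ) * (p j x) ^ 2)
      - w x * ((-1 : ℝ) ^ (j : ℕ) * (q j x) ^ 2) := by rw [hG, eu, ew]
  generalize (-1 : ℝ) ^ (j : ℕ) = s at *
  have eF : pd j F x = -(u x * pd j w x + w x * pd j u x) := by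
    have h : F = fun y => -(u y * w y) := funext hF
    have h2 := (du.mul dw).neg.fderiv
    have h3 : fderiv ℝ F x = -(u x • fderiv ℝ w x + w x • fderiv ℝ u x) := by rw [h]; exact h2
    unfold pd
    rw [h3]; simp; try ring
  have evv : pd j (pd j v) x = s * (q j x * pd j (p j) x + p j x * pd j (q j) x) := by
    have h : pd j v =ᶠ[nhds x] fun y => s * (q j y * p j y) := by
      filter_upwards [hn] with y hy using hTW2v y hy
    have h3 := h.fderiv_eq.trans ((dq.mul dp).const_mul s).fderiv
    change fderiv ℝ (pd j v) x _ = _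
    rw [h3]; simp [pd]; ring
  have eGG : pd j (G j) x = (u x * (s * (2 * p j x * pd j (p j) x)) + s * (p j x * p j x) * pd j u x)
      - (w x * (s * (2 * q j x * pd j (q j) x)) + s * (q j x * q j x) * pd j w x) := by
    have h : G j =ᶠ[nhds x] fun y => u y * (s * (p j y * p j y)) - w y * (s * (q j y * q j y)) := by
      filter_upwards [hn] with y hy
      rw [hG, hTW2u y hy, hTW2w y hy]; ring
    have h3 := h.fderiv_eq.trans ((du.mul ((dp.mul dp).const_mul s)).sub
      (dw.mul ((dq.mul dq).const_mul s))).fderiv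
    change fderiv ℝ (G j) x _ = _
    rw [h3]; simp [pd]; ring
  have eT2 : pd j T x = -(s * (p j x * pd j (q j) x - q j x * pd j (p j) x)) := by
    rw [← eT]; linear_combination (-pd j T x) * hs
  rw [eGG, evv, eF, eT2, eGx, eu, ev, ew]
  ring
end
end

section
/- In the Tracy–Widom setting with non-universal data, suppose equations (TW1), (TW2), and (TW4) hold on Ω, with all q_k, p_k C¹ and v C². Then for every index j, at every point of Ω: ∂_j(𝓓 v) = ∂_j v · (X_j + Y_j). -/
noncomputable section

theorem statement6 {N : ℕ} (hN : 2 ≤ N) (Ω : Set (Fin N → ℝ)) (hΩ : IsOpen Ω)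
    (hdist : ∀ x ∈ Ω, ∀ j l : Fin N, j ≠ l → x j ≠ x l)
    (u v w : (Fin N → ℝ) → ℝ) (q p X Y : Fin N → (Fin N → ℝ) → ℝ)
    (hq : ∀ i, ContDiffOn ℝ 1 (q i) Ω) (hp : ∀ i, ContDiffOn ℝ 1 (p i) Ω)
    (hv : ContDiffOn ℝ 2 v Ω)
    (hTW1q : ∀ (i k : Fin N), i ≠ k → ∀ x ∈ Ω,
      pd k (q i) x = (-1 : ℝ) ^ (k : ℕ) * Rjk q p i k x * q k x)
    (hTW1p : ∀ (i k : Fin N), i ≠ k → ∀ x ∈ Ω,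
      pd k (p i) x = (-1 : ℝ) ^ (k : ℕ) * Rjk q p i k x * p k x)
    (hTW2u : ∀ (i : Fin N), ∀ x ∈ Ω, pd i u x = (-1 : ℝ) ^ (i : ℕ) * (q i x) ^ 2)
    (hTW2v : ∀ (i : Fin N), ∀ x ∈ Ω, pd i v x = (-1 : ℝ) ^ (i : ℕ) * (q i x * p i x))
    (hTW2w : ∀ (i : Fin N), ∀ x ∈ Ω, pd i w x = (-1 : ℝ) ^ (i : ℕ) * (p i x) ^ 2)
    (hTW4q : ∀ (i : Fin N), ∀ x ∈ Ω,
      pd i (q i) x = q i x * X i x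
        - ∑ k ∈ Finset.univ.erase i, (-1 : ℝ) ^ (k : ℕ) * Rjk q p i k x * q k x)
    (hTW4p : ∀ (i : Fin N), ∀ x ∈ Ω,
      pd i (p i) x = p i x * Y i x
        - ∑ k ∈ Finset.univ.erase i, (-1 : ℝ) ^ (k : ℕ) * Rjk q p i k x * p k x) :
    ∀ (j : Fin N), ∀ x ∈ Ω,
      pd j (Dop v) x = pd j v x * (X j x + Y j x) := by
  intro j x hx
  have hnhds : Ω ∈ nhds x := hΩ.mem_nhds hx
  have dq : ∀ i, DifferentiableAt ℝ (q i) x := fun i =>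
    ((hq i).contDiffAt hnhds).differentiableAt (by norm_num)
  have dp : ∀ i, DifferentiableAt ℝ (p i) x := fun i =>
    ((hp i).contDiffAt hnhds).differentiableAt (by norm_num)
  have hev : Dop v =ᶠ[nhds x] fun y => ∑ k : Fin N, (-1 : ℝ) ^ (k : ℕ) * (q k y * p k y) := by
    filter_upwards [hnhds] with y hy
    simp only [Dop, Bop]
    refine Finset.sum_congr rfl fun k _ => ?_
    rw [hTW2v k y hy]
    simp
  have hder : pd j (Dop v) x
      = ∑ k : Fin N, (-1 : ℝ) ^ (k : ℕ) * (q k x * pd j (p k) x + p k x * pd j (q k) x) := by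
    have h : HasFDerivAt (fun y => ∑ k : Fin N, (-1 : ℝ) ^ (k : ℕ) * (q k y * p k y))
        (∑ k : Fin N, (-1 : ℝ) ^ (k : ℕ) • (q k x • fderiv ℝ (p k) x + p k x • fderiv ℝ (q k) x))
        x := by
      refine HasFDerivAt.fun_sum fun k _ => ?_
      exact ((dq k).hasFDerivAt.mul (dp k).hasFDerivAt).const_mul _
    unfold pd
    rw [hev.fderiv_eq, h.fderiv]
    simp [mul_add]
  have hsymm : ∀ k, Rjk q p k j x = Rjk q p j k x := by
    intro k
    simp only [Rjk]
    rw [← neg_div_neg_eq]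
    congr 1 <;> ring
  rw [hder, ← Finset.add_sum_erase _ _ (Finset.mem_univ j), hTW4q j x hx, hTW4p j x hx,
    hTW2v j x hx]
  have hrest : ∑ k ∈ Finset.univ.erase j,
      (-1 : ℝ) ^ (k : ℕ) * (q k x * pd j (p k) x + p k x * pd j (q k) x)
      = (-1 : ℝ) ^ (j : ℕ) *
        (q j x * (∑ k ∈ Finset.univ.erase j, (-1 : ℝ) ^ (k : ℕ) * Rjk q p j k x * p k x)
        + p j x * (∑ k ∈ Finset.univ.erase j, (-1 : ℝ) ^ (k : ℕ) * Rjk q p j k x * q k x)) := by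
    rw [Finset.mul_sum, Finset.mul_sum, ← Finset.sum_add_distrib, Finset.mul_sum]
    refine Finset.sum_congr rfl fun k hk => ?_
    have hkj := Finset.ne_of_mem_erase hk
    rw [hTW1q k j hkj x hx, hTW1p k j hkj x hx, hsymm k]
    ring
  rw [hrest]
  ring
end
end

section
/- (Theorem 3, equation for the Painlevé-type series.) Let v, F, G_1,…,G_N : Ω → ℝ be C¹ and T : Ω → ℝ be C², and suppose that for every j one has G_j² = (∂_j F)² + 4 F (∂_j v)², and that for every pair j ≠ l one has ∂_j F ∂_l F − G_j G_l + 4 F ∂_j v ∂_l v = 2 F (a_j − a_l)² ∂_j∂_l T. Then for all integers k, m ≥ 0, at every point of Ω: 𝓑_{k−1}F · 𝓑_{m−1}F − Ĝ_k Ĝ_m + 4 F 𝓑_{k−1}v · 𝓑_{m−1}v = 2 F (𝓑_{k+1}𝓑_{m−1} + 𝓑_{k−1}𝓑_{m+1} − 2 𝓑_k 𝓑_m) T. -/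
noncomputable section

theorem pd_diff {N : ℕ} {Ω : Set (Fin N → ℝ)} (hΩ : IsOpen Ω) {T : (Fin N → ℝ) → ℝ}
    (hT : ContDiffOn ℝ 2 T Ω) {x : Fin N → ℝ} (hx : x ∈ Ω) (l : Fin N) :
    DifferentiableAt ℝ (pd l T) x := by
  have h : ContDiffAt ℝ 2 T x := hT.contDiffAt (hΩ.mem_nhds hx)
  have h' : ContDiffAt ℝ 1 (fderiv ℝ T) x := h.fderiv_right (by norm_num)
  have h'' : DifferentiableAt ℝ (fderiv ℝ T) x := h'.differentiableAt (by norm_num)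
  exact h''.clm_apply (differentiableAt_const _)

theorem pd_sum {N : ℕ} {T : (Fin N → ℝ) → ℝ} {x : Fin N → ℝ}
    (hd : ∀ l, DifferentiableAt ℝ (pd l T) x) (n : ℕ) (j : Fin N) :
    pd j (fun y => ∑ l, (y l) ^ n * pd l T y) x
      = n * x j ^ (n - 1) * pd j T x + ∑ l, x l ^ n * pd j (pd l T) x := by
  have h : ∀ l ∈ (Finset.univ : Finset (Fin N)),
      HasFDerivAt (fun y : Fin N → ℝ => (y l) ^ n * pd l T y)
      ((x l ^ n) • fderiv ℝ (pd l T) x + (pd l T x) •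
        ((n * x l ^ (n - 1)) • (ContinuousLinearMap.proj l : (Fin N → ℝ) →L[ℝ] ℝ))) x := by
    intro l _
    have h1 : HasFDerivAt (fun y : Fin N → ℝ => y l)
      (ContinuousLinearMap.proj l : (Fin N → ℝ) →L[ℝ] ℝ) x := hasFDerivAt_apply l x
    have h2 : HasFDerivAt (fun y : Fin N → ℝ => (y l) ^ n)
      ((n * x l ^ (n - 1)) • (ContinuousLinearMap.proj l : (Fin N → ℝ) →L[ℝ] ℝ)) x :=
      (hasDerivAt_pow n (x l)).comp_hasFDerivAt x h1
    exact h2.mul (hd l).hasFDerivAt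
  have hs := (HasFDerivAt.fun_sum h).fderiv
  unfold pd at hs ⊢
  rw [hs]
  simp only [ContinuousLinearMap.sum_apply, ContinuousLinearMap.add_apply,
    ContinuousLinearMap.smul_apply, ContinuousLinearMap.proj_apply, smul_eq_mul,
    Finset.sum_add_distrib]
  rw [add_comm]
  congr 1
  rw [Finset.sum_eq_single j]
  · simp; ring
  · intro b _ hb
    simp [Pi.single_apply, hb]
  · simp

theorem Bop_Bop {N : ℕ} {T : (Fin N → ℝ) → ℝ} {x : Fin N → ℝ}
    (hd : ∀ l, DifferentiableAt ℝ (pd l T) x) (p q : ℤ) (a b : ℕ)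
    (ha : (p + 1).toNat = a) (hb : (q + 1).toNat = b) :
    Bop p (Bop q T) x = (∑ j, x j ^ a * (b * x j ^ (b - 1) * pd j T x))
      + ∑ j, ∑ l, x j ^ a * x l ^ b * pd j (pd l T) x := by
  unfold Bop
  rw [ha, hb, ← Finset.sum_add_distrib]
  refine Finset.sum_congr rfl fun j _ => ?_
  rw [pd_sum hd, mul_add, Finset.mul_sum]
  simp only [mul_assoc]

theorem statement9 {N : ℕ} (hN : 2 ≤ N) (Ω : Set (Fin N → ℝ)) (hΩ : IsOpen Ω)
    (hdist : ∀ x ∈ Ω, ∀ j l : Fin N, j ≠ l → x j ≠ x l)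
    (v F T : (Fin N → ℝ) → ℝ) (G : Fin N → (Fin N → ℝ) → ℝ)
    (hv : ContDiffOn ℝ 1 v Ω) (hF : ContDiffOn ℝ 1 F Ω)
    (hG : ∀ j, ContDiffOn ℝ 1 (G j) Ω) (hT : ContDiffOn ℝ 2 T Ω)
    (h1 : ∀ (j : Fin N), ∀ x ∈ Ω,
      (G j x) ^ 2 = (pd j F x) ^ 2 + 4 * F x * (pd j v x) ^ 2)
    (h2 : ∀ (j l : Fin N), j ≠ l → ∀ x ∈ Ω,
      pd j F x * pd l F x - G j x * G l x + 4 * F x * pd j v x * pd l v x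
        = 2 * F x * (x j - x l) ^ 2 * pd j (pd l T) x) :
    ∀ (k m : ℕ), ∀ x ∈ Ω,
      Bop ((k : ℤ) - 1) F x * Bop ((m : ℤ) - 1) F x
          - hatG (k : ℤ) G x * hatG (m : ℤ) G x
          + 4 * F x * Bop ((k : ℤ) - 1) v x * Bop ((m : ℤ) - 1) v x
        = 2 * F x * (Bop ((k : ℤ) + 1) (Bop ((m : ℤ) - 1) T) x
            + Bop ((k : ℤ) - 1) (Bop ((m : ℤ) + 1) T) x
            - 2 * Bop (k : ℤ) (Bop (m : ℤ) T) x) := by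
  intro k m x hx
  have hd := fun l => pd_diff hΩ hT hx l
  rw [Bop_Bop hd _ _ (k + 2) m (by omega) (by omega),
    Bop_Bop hd _ _ k (m + 2) (by omega) (by omega),
    Bop_Bop hd _ _ (k + 1) (m + 1) (by omega) (by omega)]
  have e0 : (∑ j, x j ^ (k + 2) * ((m : ℝ) * x j ^ (m - 1) * pd j T x))
      + (∑ j, x j ^ k * (((m + 2 : ℕ) : ℝ) * x j ^ (m + 2 - 1) * pd j T x))
      - 2 * (∑ j, x j ^ (k + 1) * (((m + 1 : ℕ) : ℝ) * x j ^ (m + 1 - 1) * pd j T x)) = 0 := by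
    rw [Finset.mul_sum, ← Finset.sum_add_distrib, ← Finset.sum_sub_distrib]
    refine Finset.sum_eq_zero fun j _ => ?_
    rcases m with _ | m
    · simp; ring
    · simp only [Nat.add_sub_cancel, show m + 1 + 2 - 1 = m + 2 by omega]
      push_cast
      ring
  have e1 : Bop ((k : ℤ) - 1) F x * Bop ((m : ℤ) - 1) F x
          - hatG (k : ℤ) G x * hatG (m : ℤ) G x
          + 4 * F x * Bop ((k : ℤ) - 1) v x * Bop ((m : ℤ) - 1) v x
      = ∑ j, ∑ l, x j ^ k * x l ^ m * (pd j F x * pd l F x - G j x * G l x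
          + 4 * F x * pd j v x * pd l v x) := by
    unfold Bop hatG
    simp only [sub_add_cancel, Int.toNat_natCast]
    rw [mul_assoc (4 * F x), Finset.sum_mul_sum, Finset.sum_mul_sum, Finset.sum_mul_sum,
      Finset.mul_sum, ← Finset.sum_sub_distrib, ← Finset.sum_add_distrib]
    refine Finset.sum_congr rfl fun j _ => ?_
    rw [Finset.mul_sum, ← Finset.sum_sub_distrib, ← Finset.sum_add_distrib]
    refine Finset.sum_congr rfl fun l _ => ?_
    ring
  have e2 : (∑ j, ∑ l, x j ^ (k + 2) * x l ^ m * pd j (pd l T) x)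
      + (∑ j, ∑ l, x j ^ k * x l ^ (m + 2) * pd j (pd l T) x)
      - 2 * (∑ j, ∑ l, x j ^ (k + 1) * x l ^ (m + 1) * pd j (pd l T) x)
      = ∑ j, ∑ l, x j ^ k * x l ^ m * ((x j - x l) ^ 2 * pd j (pd l T) x) := by
    simp only [Finset.mul_sum, ← Finset.sum_sub_distrib, ← Finset.sum_add_distrib]
    refine Finset.sum_congr rfl fun j _ => Finset.sum_congr rfl fun l _ => ?_
    ring
  have e3 : ∑ j, ∑ l, x j ^ k * x l ^ m * (pd j F x * pd l F x - G j x * G l x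
          + 4 * F x * pd j v x * pd l v x)
      = 2 * F x * ∑ j, ∑ l, x j ^ k * x l ^ m * ((x j - x l) ^ 2 * pd j (pd l T) x) := by
    simp only [Finset.mul_sum]
    refine Finset.sum_congr rfl fun j _ => Finset.sum_congr rfl fun l _ => ?_
    by_cases hjl : j = l
    · subst hjl
      linear_combination (-(x j ^ k * x j ^ m)) * h1 j x hx
    · linear_combination (x j ^ k * x l ^ m) * h2 j l hjl x hx
  rw [e1, e3]
  linear_combination (-2 * F x) * e2 - 2 * F x * e0
end
end

section
/- (Theorem 3, A-series.) Let v : Ω → ℝ be C², F : Ω → ℝ be C¹, and G_1,…,G_N : Ω → ℝ be functions such that for every pair j ≠ l one has G_l ∂_j F − G_j ∂_l F = 2 F (a_j − a_l) ∂_j∂_l v. Then for all integers k, m ≥ 0, at every point of Ω: Ĝ_m 𝓑_{k−1}F − Ĝ_k 𝓑_{m−1}F = 2 F (𝓑_k 𝓑_{m−1} − 𝓑_{k−1} 𝓑_m + 𝓑_{k+m−1}) v. -/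
noncomputable section

theorem pd_sum_aux {N : ℕ} (Ω : Set (Fin N → ℝ)) (hΩ : IsOpen Ω)
    (v : (Fin N → ℝ) → ℝ) (hv : ContDiffOn ℝ 2 v Ω) (n : ℕ) (x : Fin N → ℝ) (hx : x ∈ Ω)
    (j : Fin N) :
    pd j (fun y => ∑ l, (y l) ^ n * pd l v y) x
      = (n : ℝ) * x j ^ (n - 1) * pd j v x + ∑ l, x l ^ n * pd j (pd l v) x := by
  have hd : ∀ l : Fin N, DifferentiableAt ℝ (pd l v) x := by
    intro l
    have h1 : ContDiffAt ℝ 2 v x := hv.contDiffAt (hΩ.mem_nhds hx)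
    have h2 : ContDiffAt ℝ 1 (fderiv ℝ v) x := h1.fderiv_right (by norm_num)
    exact (h2.differentiableAt (by norm_num)).clm_apply (differentiableAt_const _)
  have hp : ∀ l : Fin N, HasFDerivAt (fun y : Fin N → ℝ => y l ^ n)
      (((n : ℝ) * x l ^ (n - 1)) • (ContinuousLinearMap.proj (R := ℝ) (φ := fun _ : Fin N => ℝ) l)) x := by
    intro l
    have := (hasDerivAt_pow n (x l)).comp_hasFDerivAt x
      (ContinuousLinearMap.proj (R := ℝ) (φ := fun _ : Fin N => ℝ) l).hasFDerivAt
    exact this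
  have hs := HasFDerivAt.fun_sum (u := Finset.univ) (fun l _ => (hp l).mul (hd l).hasFDerivAt)
  have he := hs.fderiv
  unfold pd at he ⊢
  simp only [Pi.mul_apply] at he
  rw [he]
  simp only [ContinuousLinearMap.sum_apply, ContinuousLinearMap.add_apply,
    ContinuousLinearMap.smul_apply, ContinuousLinearMap.proj_apply, smul_eq_mul,
    Finset.sum_add_distrib, Pi.single_apply]
  rw [add_comm]
  congr 1
  simp
  ring

theorem statement10 {N : ℕ} (hN : 2 ≤ N) (Ω : Set (Fin N → ℝ)) (hΩ : IsOpen Ω)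
    (hdist : ∀ x ∈ Ω, ∀ j l : Fin N, j ≠ l → x j ≠ x l)
    (v F : (Fin N → ℝ) → ℝ) (G : Fin N → (Fin N → ℝ) → ℝ)
    (hv : ContDiffOn ℝ 2 v Ω) (hF : ContDiffOn ℝ 1 F Ω)
    (h : ∀ (j l : Fin N), j ≠ l → ∀ x ∈ Ω,
      G l x * pd j F x - G j x * pd l F x = 2 * F x * (x j - x l) * pd j (pd l v) x) :
    ∀ (k m : ℕ), ∀ x ∈ Ω,
      hatG (m : ℤ) G x * Bop ((k : ℤ) - 1) F x - hatG (k : ℤ) G x * Bop ((m : ℤ) - 1) F x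
        = 2 * F x * (Bop (k : ℤ) (Bop ((m : ℤ) - 1) v) x
            - Bop ((k : ℤ) - 1) (Bop (m : ℤ) v) x
            + Bop ((k : ℤ) + (m : ℤ) - 1) v x) := by
  intro k m x hx
  have e1 : ((k : ℤ) - 1 + 1).toNat = k := by omega
  have e2 : ((m : ℤ) - 1 + 1).toNat = m := by omega
  have e3 : ((k : ℤ) + 1).toNat = k + 1 := by omega
  have e4 : ((m : ℤ) + 1).toNat = m + 1 := by omega
  have e5 : ((k : ℤ) + (m : ℤ) - 1 + 1).toNat = k + m := by omega
  unfold Bop hatG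
  simp only [e1, e2, e3, e4, e5, Int.toNat_natCast]
  simp only [pd_sum_aux Ω hΩ v hv _ x hx]
  have hL : (∑ j, x j ^ m * G j x) * (∑ j, x j ^ k * pd j F x)
      - (∑ j, x j ^ k * G j x) * (∑ j, x j ^ m * pd j F x)
      = ∑ j, ∑ l, x j ^ k * x l ^ m * (2 * F x * (x j - x l) * pd j (pd l v) x) := by
    rw [mul_comm (∑ j, x j ^ m * G j x), Finset.sum_mul_sum, Finset.sum_mul_sum,
      ← Finset.sum_sub_distrib]
    refine Finset.sum_congr rfl fun j _ => ?_
    rw [← Finset.sum_sub_distrib]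
    refine Finset.sum_congr rfl fun l _ => ?_
    by_cases hjl : j = l
    · subst hjl; ring
    · rw [← h j l hjl x hx]; ring
  rw [hL, ← Finset.sum_sub_distrib, ← Finset.sum_add_distrib, Finset.mul_sum]
  refine Finset.sum_congr rfl fun j _ => ?_
  have hm : (m : ℝ) * x j ^ (m - 1) * x j = m * x j ^ m := by
    cases m with
    | zero => simp
    | succ n => simp [pow_succ]; ring
  have hS : ∑ l, x j ^ k * x l ^ m * (2 * F x * (x j - x l) * pd j (pd l v) x)
      = 2 * F x * (x j ^ (k + 1) * ∑ l, x l ^ m * pd j (pd l v) x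
        - x j ^ k * ∑ l, x l ^ (m + 1) * pd j (pd l v) x) := by
    rw [Finset.mul_sum, Finset.mul_sum, ← Finset.sum_sub_distrib, Finset.mul_sum]
    refine Finset.sum_congr rfl fun l _ => ?_
    ring
  rw [hS]
  push_cast
  linear_combination (-(2 * F x * x j ^ k * pd j v x)) * hm
end
end

section
/- (Theorem 3, G-series.) Let v : Ω → ℝ be C², F : Ω → ℝ be C¹, and G_1,…,G_N : Ω → ℝ be C¹ functions such that for every pair j ≠ l one has both (a_j − a_l)(∂_j G_l + ∂_l G_j) = 4 (∂_l v ∂_j F − ∂_j v ∂_l F) and ∂_j G_l − ∂_l G_j = 2 (a_j − a_l) ∂_j∂_l v. Then for all integers k, m ≥ 0, at every point of Ω: 𝓑_{m−1}Ĝ_{k+1} − 𝓑_m Ĝ_k − Ĝ_{k+m} = 2 (𝓑_{m−1}v · 𝓑_{k−1}F − 𝓑_{k−1}v · 𝓑_{m−1}F) − (𝓑_{k+1}𝓑_{m−1} + 𝓑_{k−1}𝓑_{m+1} − 2 𝓑_k 𝓑_m) v. -/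
noncomputable section

theorem pd_wsum {N : ℕ} (n : ℕ) (H : Fin N → (Fin N → ℝ) → ℝ) (x : Fin N → ℝ)
    (hH : ∀ j, DifferentiableAt ℝ (H j) x) (i : Fin N) :
    pd i (fun y => ∑ j, (y j) ^ n * H j y) x
      = (n : ℝ) * x i ^ (n - 1) * H i x + ∑ j, x j ^ n * pd i (H j) x := by
  have h1 : ∀ j : Fin N, HasFDerivAt (fun y : Fin N → ℝ => y j)
      (ContinuousLinearMap.proj (R := ℝ) (φ := fun _ : Fin N => ℝ) j) x :=
    fun j => (ContinuousLinearMap.proj (R := ℝ) (φ := fun _ : Fin N => ℝ) j).hasFDerivAt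
  have h2 := HasFDerivAt.fun_sum (u := Finset.univ)
    (fun j _ => ((h1 j).pow n).mul (hH j).hasFDerivAt)
  unfold pd
  have h3 := h2.fderiv
  simp only [Pi.mul_apply] at h3
  rw [h3]
  simp [Finset.sum_add_distrib, Pi.single_apply]
  ring

theorem Bop_wsum {N : ℕ} (n p : ℕ) (H : Fin N → (Fin N → ℝ) → ℝ) (x : Fin N → ℝ)
    (hH : ∀ j, DifferentiableAt ℝ (H j) x) (q : ℤ) (hq : (q + 1).toNat = p) :
    Bop q (fun y => ∑ j, (y j) ^ n * H j y) x
      = ∑ i, x i ^ p * ((n : ℝ) * x i ^ (n - 1) * H i x)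
        + ∑ i, ∑ j, x i ^ p * (x j ^ n * pd i (H j) x) := by
  unfold Bop
  rw [hq, ← Finset.sum_add_distrib]
  refine Finset.sum_congr rfl fun i _ => ?_
  rw [pd_wsum n H x hH i, mul_add, Finset.mul_sum]

theorem statement12 {N : ℕ} (hN : 2 ≤ N) (Ω : Set (Fin N → ℝ)) (hΩ : IsOpen Ω)
    (hdist : ∀ x ∈ Ω, ∀ j l : Fin N, j ≠ l → x j ≠ x l)
    (v F : (Fin N → ℝ) → ℝ) (G : Fin N → (Fin N → ℝ) → ℝ)
    (hv : ContDiffOn ℝ 2 v Ω) (hF : ContDiffOn ℝ 1 F Ω)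
    (hG : ∀ j, ContDiffOn ℝ 1 (G j) Ω)
    (hGsum : ∀ (j l : Fin N), j ≠ l → ∀ x ∈ Ω,
      (x j - x l) * (pd j (G l) x + pd l (G j) x)
        = 4 * (pd l v x * pd j F x - pd j v x * pd l F x))
    (hGdiff : ∀ (j l : Fin N), j ≠ l → ∀ x ∈ Ω,
      pd j (G l) x - pd l (G j) x = 2 * (x j - x l) * pd j (pd l v) x) :
    ∀ (k m : ℕ), ∀ x ∈ Ω,
      Bop ((m : ℤ) - 1) (hatG ((k : ℤ) + 1) G) x - Bop (m : ℤ) (hatG (k : ℤ) G) x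
          - hatG ((k : ℤ) + (m : ℤ)) G x
        = 2 * (Bop ((m : ℤ) - 1) v x * Bop ((k : ℤ) - 1) F x
            - Bop ((k : ℤ) - 1) v x * Bop ((m : ℤ) - 1) F x)
          - (Bop ((k : ℤ) + 1) (Bop ((m : ℤ) - 1) v) x
            + Bop ((k : ℤ) - 1) (Bop ((m : ℤ) + 1) v) x
            - 2 * Bop (k : ℤ) (Bop (m : ℤ) v) x) := by
  intro k m x hx
  have hGd : ∀ j, DifferentiableAt ℝ (G j) x := fun j =>
    ((hG j).contDiffAt (hΩ.mem_nhds hx)).differentiableAt (by norm_num)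
  have hvd : ∀ j, DifferentiableAt ℝ (pd j v) x := fun j => by
    have h := ((hv.contDiffAt (hΩ.mem_nhds hx)).fderiv_right (m := 1) (by norm_num)).differentiableAt
      (by norm_num)
    exact h.clm_apply (differentiableAt_const _)
  have eB : ∀ (q : ℤ) (n : ℕ), (q + 1).toNat = n → ∀ f : (Fin N → ℝ) → ℝ,
      Bop q f = fun y => ∑ j, (y j) ^ n * pd j f y := by
    intro q n h f
    subst h
    rfl
  have eG : ∀ (q : ℤ) (n : ℕ), q.toNat = n →
      hatG q G = fun y => ∑ j, (y j) ^ n * G j y := by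
    intro q n h
    subst h
    rfl
  rw [eG ((k : ℤ) + 1) (k + 1) (by omega), eG (k : ℤ) k (by omega),
    eG ((k : ℤ) + m) (k + m) (by omega),
    eB ((m : ℤ) - 1) m (by omega) v, eB ((m : ℤ) + 1) (m + 2) (by omega) v,
    eB (m : ℤ) (m + 1) (by omega) v,
    Bop_wsum (k + 1) m G x hGd _ (by omega), Bop_wsum k (m + 1) G x hGd _ (by omega),
    Bop_wsum m (k + 2) (fun j => pd j v) x hvd _ (by omega),
    Bop_wsum (m + 2) k (fun j => pd j v) x hvd _ (by omega),
    Bop_wsum (m + 1) (k + 1) (fun j => pd j v) x hvd _ (by omega),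
    eB ((k : ℤ) - 1) k (by omega) v, eB ((k : ℤ) - 1) k (by omega) F,
    eB ((m : ℤ) - 1) m (by omega) F]
  have hp : ∀ (n : ℕ) (a : ℝ), (n : ℝ) * a ^ (n - 1) * a = n * a ^ n := by
    intro n a
    cases n with
    | zero => simp
    | succ n => simp [pow_succ]; ring
  have A1 : ∑ i, x i ^ m * (((k + 1 : ℕ) : ℝ) * x i ^ (k + 1 - 1) * G i x)
      - ∑ i, x i ^ (m + 1) * ((k : ℝ) * x i ^ (k - 1) * G i x)
      - ∑ i, x i ^ (k + m) * G i x = 0 := by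
    rw [← Finset.sum_sub_distrib, ← Finset.sum_sub_distrib]
    refine Finset.sum_eq_zero fun i _ => ?_
    have := hp k (x i)
    simp only [Nat.add_sub_cancel]
    push_cast
    linear_combination (-(x i ^ m * G i x)) * this
  have A2 : ∑ i, x i ^ (k + 2) * ((m : ℝ) * x i ^ (m - 1) * pd i v x)
      + ∑ i, x i ^ k * (((m + 2 : ℕ) : ℝ) * x i ^ (m + 2 - 1) * pd i v x)
      - 2 * ∑ i, x i ^ (k + 1) * (((m + 1 : ℕ) : ℝ) * x i ^ (m + 1 - 1) * pd i v x) = 0 := by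
    rw [Finset.mul_sum, ← Finset.sum_add_distrib, ← Finset.sum_sub_distrib]
    refine Finset.sum_eq_zero fun i _ => ?_
    have := hp m (x i)
    have e : m + 2 - 1 = m + 1 := by omega
    simp only [Nat.add_sub_cancel, e]
    push_cast
    linear_combination (x i ^ (k + 1) * pd i v x) * this
  have A3 : ∑ i, ∑ j, x i ^ m * (x j ^ (k + 1) * pd i (G j) x)
      - ∑ i, ∑ j, x i ^ (m + 1) * (x j ^ k * pd i (G j) x)
      = 2 * ((∑ j, x j ^ m * pd j v x) * (∑ j, x j ^ k * pd j F x)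
          - (∑ j, x j ^ k * pd j v x) * (∑ j, x j ^ m * pd j F x))
        - (∑ i, ∑ j, x i ^ (k + 2) * (x j ^ m * pd i (pd j v) x)
          + ∑ i, ∑ j, x i ^ k * (x j ^ (m + 2) * pd i (pd j v) x)
          - 2 * ∑ i, ∑ j, x i ^ (k + 1) * (x j ^ (m + 1) * pd i (pd j v) x)) := by
    rw [Finset.sum_comm (f := fun i j => x i ^ (k + 2) * (x j ^ m * pd i (pd j v) x)),
      Finset.sum_comm (f := fun i j => x i ^ k * (x j ^ (m + 2) * pd i (pd j v) x)),
      Finset.sum_comm (f := fun i j => x i ^ (k + 1) * (x j ^ (m + 1) * pd i (pd j v) x)),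
      mul_comm (∑ j, x j ^ k * pd j v x)]
    rw [Finset.sum_mul_sum, Finset.sum_mul_sum]
    simp only [Finset.mul_sum, ← Finset.sum_add_distrib,
      ← Finset.sum_sub_distrib]
    refine Finset.sum_congr rfl fun i _ => Finset.sum_congr rfl fun j _ => ?_
    by_cases hij : i = j
    · subst hij
      ring
    · have s := hGsum i j hij x hx
      have d := hGdiff j i (Ne.symm hij) x hx
      linear_combination (-(x i ^ m * x j ^ k) / 2) * s
        + (x i ^ m * x j ^ k * (x i - x j) / 2) * d
  linear_combination A1 + A3 + A2
end
end

section
/- (Theorem 4, first universal two-point PDE.) Fix indices j ≠ l. Let T, v, F : Ω → ℝ be C² and G_j, G_l : Ω → ℝ functions with F nonvanishing on Ω, and suppose at every point of Ω: G_j² = (∂_j F)² + 4 F (∂_j v)², G_l² = (∂_l F)² + 4 F (∂_l v)², ∂_j F ∂_l F − G_j G_l + 4 F ∂_j v ∂_l v = 2 F (a_j − a_l)² ∂_j∂_l T, and G_l ∂_j F − G_j ∂_l F = 2 F (a_j − a_l) ∂_j∂_l v. Then at every point of Ω: (∂_j∂_l v)² − (a_j − a_l)² (∂_j∂_l T)²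 + 4 ∂_j∂_l T ∂_j v ∂_l v = 0. -/
noncomputable section

theorem alg_aux (a b g h p q f d t w : ℝ) (hf : f ≠ 0) (hd : d ≠ 0)
    (h1 : g ^ 2 = a ^ 2 + 4 * f * p ^ 2) (h2 : h ^ 2 = b ^ 2 + 4 * f * q ^ 2)
    (h3 : a * b - g * h + 4 * f * p * q = 2 * f * d ^ 2 * t)
    (h4 : h * a - g * b = 2 * f * d * w) :
    w ^ 2 - d ^ 2 * t ^ 2 + 4 * t * p * q = 0 := by
  have e : 4 * f ^ 2 * d ^ 2 * (w ^ 2 - d ^ 2 * t ^ 2 + 4 * t * p * q) = 0 := by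
    have e1 : 4 * f ^ 2 * d ^ 2 * (w ^ 2 - d ^ 2 * t ^ 2 + 4 * t * p * q)
      = (2 * f * d * w) ^ 2 - (2 * f * d ^ 2 * t - 4 * f * p * q) ^ 2
        + (4 * f * p ^ 2) * (4 * f * q ^ 2) := by ring
    have e2 : 4 * f * p ^ 2 = g ^ 2 - a ^ 2 := by linarith
    have e3 : 4 * f * q ^ 2 = h ^ 2 - b ^ 2 := by linarith
    rw [e1, ← h3, ← h4, e2, e3]
    ring
  exact (mul_eq_zero.mp e).resolve_left (by positivity)

theorem statement13 {N : ℕ} (hN : 2 ≤ N) (Ω : Set (Fin N → ℝ)) (hΩ : IsOpen Ω)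
    (hdist : ∀ x ∈ Ω, ∀ j l : Fin N, j ≠ l → x j ≠ x l)
    (T v F Gj Gl : (Fin N → ℝ) → ℝ)
    (j l : Fin N) (hjl : j ≠ l)
    (hT : ContDiffOn ℝ 2 T Ω) (hv : ContDiffOn ℝ 2 v Ω) (hF : ContDiffOn ℝ 2 F Ω)
    (hFne : ∀ x ∈ Ω, F x ≠ 0)
    (h1 : ∀ x ∈ Ω, (Gj x) ^ 2 = (pd j F x) ^ 2 + 4 * F x * (pd j v x) ^ 2)
    (h2 : ∀ x ∈ Ω, (Gl x) ^ 2 = (pd l F x) ^ 2 + 4 * F x * (pd l v x) ^ 2)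
    (h3 : ∀ x ∈ Ω,
      pd j F x * pd l F x - Gj x * Gl x + 4 * F x * pd j v x * pd l v x
        = 2 * F x * (x j - x l) ^ 2 * pd j (pd l T) x)
    (h4 : ∀ x ∈ Ω,
      Gl x * pd j F x - Gj x * pd l F x = 2 * F x * (x j - x l) * pd j (pd l v) x) :
    ∀ x ∈ Ω,
      (pd j (pd l v) x) ^ 2 - (x j - x l) ^ 2 * (pd j (pd l T) x) ^ 2
        + 4 * pd j (pd l T) x * pd j v x * pd l v x = 0 := by
  intro x hx
  exact alg_aux _ _ _ _ _ _ _ _ _ _ (hFne x hx) (sub_ne_zero.mpr (hdist x hx j l hjl))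
    (h1 x hx) (h2 x hx) (h3 x hx) (h4 x hx)
end
end

section
/- (Theorem 4, second universal two-point PDE.) Fix indices j ≠ l. Let T, v, F : Ω → ℝ be C² and G_j, G_l : Ω → ℝ functions with F nonvanishing on Ω, and suppose at every point of Ω: G_j² = (∂_j F)² + 4 F (∂_j v)², G_l² = (∂_l F)² + 4 F (∂_l v)², ∂_j F ∂_l F − G_j G_l + 4 F ∂_j v ∂_l v = 2 F (a_j − a_l)² ∂_j∂_l T, and G_l ∂_j F − G_j ∂_l F = 2 F (a_j − a_l) ∂_j∂_l v. Then at every point of Ω: (a_j − a_l)² (F (∂_j∂_l v)² − ∂_j∂_l T · ∂_j F ∂_l F) − (∂_l v ∂_j F − ∂_j v ∂_l F)² = 0. -/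
noncomputable section

theorem statement14 {N : ℕ} (hN : 2 ≤ N) (Ω : Set (Fin N → ℝ)) (hΩ : IsOpen Ω)
    (hdist : ∀ x ∈ Ω, ∀ j l : Fin N, j ≠ l → x j ≠ x l)
    (T v F Gj Gl : (Fin N → ℝ) → ℝ)
    (j l : Fin N) (hjl : j ≠ l)
    (hT : ContDiffOn ℝ 2 T Ω) (hv : ContDiffOn ℝ 2 v Ω) (hF : ContDiffOn ℝ 2 F Ω)
    (hFne : ∀ x ∈ Ω, F x ≠ 0)
    (h1 : ∀ x ∈ Ω, (Gj x) ^ 2 = (pd j F x) ^ 2 + 4 * F x * (pd j v x) ^ 2)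
    (h2 : ∀ x ∈ Ω, (Gl x) ^ 2 = (pd l F x) ^ 2 + 4 * F x * (pd l v x) ^ 2)
    (h3 : ∀ x ∈ Ω,
      pd j F x * pd l F x - Gj x * Gl x + 4 * F x * pd j v x * pd l v x
        = 2 * F x * (x j - x l) ^ 2 * pd j (pd l T) x)
    (h4 : ∀ x ∈ Ω,
      Gl x * pd j F x - Gj x * pd l F x = 2 * F x * (x j - x l) * pd j (pd l v) x) :
    ∀ x ∈ Ω,
      (x j - x l) ^ 2 * (F x * (pd j (pd l v) x) ^ 2
          - pd j (pd l T) x * pd j F x * pd l F x)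
        - (pd l v x * pd j F x - pd j v x * pd l F x) ^ 2 = 0 := by
  intro x hx
  have hF0 : (4 * F x) ≠ 0 := mul_ne_zero (by norm_num) (hFne x hx)
  refine (mul_eq_zero.mp ?_).resolve_left hF0
  linear_combination (-(Gl x * pd j F x - Gj x * pd l F x
    + 2 * F x * (x j - x l) * pd j (pd l v) x)) * h4 x hx
    + (pd j F x) ^ 2 * h2 x hx + (pd l F x) ^ 2 * h1 x hx
    + 2 * pd j F x * pd l F x * h3 x hx
end
end

section
/- (Theorem 5, GUE one-point third-order PDE, first equation.) Let n be a real constant, T : Ω → ℝ a C³ function, and define the Gaussian auxiliary functions v, F, G_j by 2v = 𝓓T, 4F = 𝓓²T + 2n, 2G_j = ∂_j(𝓑_0 T) − 2a_j ∂_j(𝓓T). Fix an index j and suppose that at every point of Ω the universal equation ∂_j v · ∂_j G_j = G_j ∂_j∂_j v − ∂_j T · ∂_j F holds. Then at every point of Ω: ∂_j(𝓑_0 T) · ∂_j∂_j(𝓓T) − ∂_j(𝓓T) · ∂_j∂_j(𝓑_0 T) = ∂_j T · ∂_j(𝓓²T) − 2 (∂_j(𝓓T))². -/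
noncomputable section

theorem pd_contDiffOn_aux {N : ℕ} {Ω : Set (Fin N → ℝ)} (hΩ : IsOpen Ω) (j : Fin N)
    {f : (Fin N → ℝ) → ℝ} {m k : ℕ} (hmk : m + 1 = k) (hf : ContDiffOn ℝ k f Ω) :
    ContDiffOn ℝ m (pd j f) Ω := by
  subst hmk
  have h : ContDiffOn ℝ m (fderiv ℝ f) Ω :=
    hf.fderiv_of_isOpen hΩ (by push_cast; exact le_rfl)
  exact h.clm_apply contDiffOn_const

theorem Bop_contDiffOn_aux {N : ℕ} {Ω : Set (Fin N → ℝ)} (hΩ : IsOpen Ω) (i : ℤ)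
    {f : (Fin N → ℝ) → ℝ} {m k : ℕ} (hmk : m + 1 = k) (hf : ContDiffOn ℝ k f Ω) :
    ContDiffOn ℝ m (Bop i f) Ω := by
  unfold Bop
  refine ContDiffOn.sum fun j _ => ContDiffOn.mul ?_ (pd_contDiffOn_aux hΩ j hmk hf)
  exact ((contDiff_apply ℝ ℝ j).pow _).contDiffOn

theorem pd_const_mul_aux {N : ℕ} (j : Fin N) (c : ℝ) (f : (Fin N → ℝ) → ℝ) :
    pd j (fun x => c * f x) = fun x => c * pd j f x := by
  funext x
  have : (fun x => c * f x) = c • f := rfl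
  simp only [pd]
  rw [this, fderiv_const_smul_field]
  simp

theorem statement15 {N : ℕ} (hN : 2 ≤ N) (Ω : Set (Fin N → ℝ)) (hΩ : IsOpen Ω)
    (hdist : ∀ x ∈ Ω, ∀ j l : Fin N, j ≠ l → x j ≠ x l)
    (n : ℝ) (T : (Fin N → ℝ) → ℝ) (hT : ContDiffOn ℝ 3 T Ω)
    (v F : (Fin N → ℝ) → ℝ) (G : Fin N → (Fin N → ℝ) → ℝ)
    (hv : ∀ x, 2 * v x = Dop T x)
    (hF : ∀ x, 4 * F x = Dop (Dop T) x + 2 * n)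
    (hG : ∀ (i : Fin N) x, 2 * G i x = pd i (Bop 0 T) x - 2 * x i * pd i (Dop T) x)
    (j : Fin N)
    (huniv : ∀ x ∈ Ω,
      pd j v x * pd j (G j) x = G j x * pd j (pd j v) x - pd j T x * pd j F x) :
    ∀ x ∈ Ω,
      pd j (Bop 0 T) x * pd j (pd j (Dop T)) x
          - pd j (Dop T) x * pd j (pd j (Bop 0 T)) x
        = pd j T x * pd j (Dop (Dop T)) x - 2 * (pd j (Dop T) x) ^ 2 := by
  intro x hx
  have hB : ContDiffOn ℝ (1 : ℕ) (pd j (Bop 0 T)) Ω :=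
    pd_contDiffOn_aux hΩ j (k := 2) rfl (Bop_contDiffOn_aux hΩ 0 (k := 3) rfl hT)
  have hD : ContDiffOn ℝ (1 : ℕ) (pd j (Dop T)) Ω :=
    pd_contDiffOn_aux hΩ j (k := 2) rfl (Bop_contDiffOn_aux hΩ (-1) (k := 3) rfl hT)
  have hBd : DifferentiableAt ℝ (pd j (Bop 0 T)) x :=
    (hB.differentiableOn (by simp)).differentiableAt (hΩ.mem_nhds hx)
  have hDd : DifferentiableAt ℝ (pd j (Dop T)) x :=
    (hD.differentiableOn (by simp)).differentiableAt (hΩ.mem_nhds hx)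
  have ev : v = fun y => (1 / 2) * Dop T y := by
    funext y; linarith [hv y]
  have e1 : pd j v = fun y => (1 / 2) * pd j (Dop T) y := by
    rw [ev, pd_const_mul_aux]
  have e2 : pd j (pd j v) x = (1 / 2) * pd j (pd j (Dop T)) x := by
    rw [e1, pd_const_mul_aux]
  have eF : pd j F x = (1 / 4) * pd j (Dop (Dop T)) x := by
    have : F = fun y => (1 / 4) * Dop (Dop T) y + n / 2 := by
      funext y; linarith [hF y]
    rw [this]
    have h := congrFun (pd_const_mul_aux j (1 / 4) (Dop (Dop T))) x
    simp only [pd] at h ⊢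
    rw [fderiv_add_const]
    exact h
  have eG : pd j (G j) x = (1 / 2) * pd j (pd j (Bop 0 T)) x
      - (pd j (Dop T) x + x j * pd j (pd j (Dop T)) x) := by
    have : G j = fun y => (1 / 2) * pd j (Bop 0 T) y - y j * pd j (Dop T) y := by
      funext y; linarith [hG j y]
    rw [this]
    have hc : HasFDerivAt (fun y : Fin N → ℝ => y j)
        (ContinuousLinearMap.proj (R := ℝ) (φ := fun _ : Fin N => ℝ) j) x :=
      hasFDerivAt_apply j x
    have h := (hBd.hasFDerivAt.const_mul (1 / 2)).sub (hc.mul hDd.hasFDerivAt)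
    have h2 := h.fderiv
    have h3 := congrArg (fun L => L (Pi.single j 1)) h2
    refine Eq.trans h3 ?_
    simp [pd]
    ring
  have hu := huniv x hx
  rw [e2, eF, eG, e1] at hu
  have hg := hG j x
  have hg' : G j x = (1 / 2) * pd j (Bop 0 T) x - x j * pd j (Dop T) x := by linarith
  rw [hg'] at hu
  simp only at hu
  linear_combination (-4) * hu
end
end

section
/- (Theorem 8, GUE second-order PDE.) Let n be a real constant, T : Ω → ℝ a C² function, and define the Gaussian auxiliary functions v, F, G_j by 2v = 𝓓T, 4F = 𝓓²T + 2n, 2G_j = ∂_j(𝓑_0 T) − 2a_j ∂_j(𝓓T); assume 𝓓²T + 2n is nonvanishing on Ω. Fix indices j ≠ l and suppose that at every point of Ω: G_j² = (∂_j F)² + 4 F (∂_j v)², G_l² = (∂_l F)² + 4 F (∂_l v)², and ∂_j F ∂_l F − G_j G_l + 4 F ∂_j v ∂_l v = 2 F (a_j − a_l)² ∂_j∂_l T. Then at every point of Ω: (∂_l(𝓓T)(∂_j(𝓑_0 T) − 2a_j ∂_j(𝓓T)) − ∂_j(𝓓T)(∂_l(𝓑_0 T) − 2a_l ∂_l(𝓓T)))²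 = 4 (a_j − a_l)² ∂_j∂_l T · (−(∂_j(𝓑_0 T) − 2a_j ∂_j(𝓓T))(∂_l(𝓑_0 T) − 2a_l ∂_l(𝓓T)) + (𝓓²T + 2n)(∂_j(𝓓T) ∂_l(𝓓T) − (a_j − a_l)² ∂_j∂_l T)). -/
noncomputable section

theorem statement18 {N : ℕ} (hN : 2 ≤ N) (Ω : Set (Fin N → ℝ)) (hΩ : IsOpen Ω)
    (hdist : ∀ x ∈ Ω, ∀ j l : Fin N, j ≠ l → x j ≠ x l)
    (n : ℝ) (T : (Fin N → ℝ) → ℝ) (hT : ContDiffOn ℝ 2 T Ω)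
    (v F : (Fin N → ℝ) → ℝ) (G : Fin N → (Fin N → ℝ) → ℝ)
    (hv : ∀ x, 2 * v x = Dop T x)
    (hF : ∀ x, 4 * F x = Dop (Dop T) x + 2 * n)
    (hG : ∀ (i : Fin N) x, 2 * G i x = pd i (Bop 0 T) x - 2 * x i * pd i (Dop T) x)
    (hFne : ∀ x ∈ Ω, Dop (Dop T) x + 2 * n ≠ 0)
    (j l : Fin N) (hjl : j ≠ l)
    (h1 : ∀ x ∈ Ω, (G j x) ^ 2 = (pd j F x) ^ 2 + 4 * F x * (pd j v x) ^ 2)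
    (h2 : ∀ x ∈ Ω, (G l x) ^ 2 = (pd l F x) ^ 2 + 4 * F x * (pd l v x) ^ 2)
    (h3 : ∀ x ∈ Ω,
      pd j F x * pd l F x - G j x * G l x + 4 * F x * pd j v x * pd l v x
        = 2 * F x * (x j - x l) ^ 2 * pd j (pd l T) x) :
    ∀ x ∈ Ω,
      (pd l (Dop T) x * (pd j (Bop 0 T) x - 2 * x j * pd j (Dop T) x)
          - pd j (Dop T) x * (pd l (Bop 0 T) x - 2 * x l * pd l (Dop T) x)) ^ 2
        = 4 * (x j - x l) ^ 2 * pd j (pd l T) x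
            * (-((pd j (Bop 0 T) x - 2 * x j * pd j (Dop T) x)
                  * (pd l (Bop 0 T) x - 2 * x l * pd l (Dop T) x))
              + (Dop (Dop T) x + 2 * n)
                  * (pd j (Dop T) x * pd l (Dop T) x
                    - (x j - x l) ^ 2 * pd j (pd l T) x)) := by
  intro x hx
  have hvD : Dop T = (2 : ℝ) • v := by
    funext y
    simp [← hv y]
  have hpd : ∀ i : Fin N, pd i (Dop T) x = 2 * pd i v x := by
    intro i
    unfold pd
    rw [hvD, fderiv_const_smul_field]
    simp
  have hF0 : F x ≠ 0 := by
    intro h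
    apply hFne x hx
    rw [← hF x, h, mul_zero]
  have e1 := h1 x hx
  have e2 := h2 x hx
  have e3 := h3 x hx
  rw [← hG j x, ← hG l x, ← hF x, hpd j, hpd l]
  generalize G j x = a at *
  generalize G l x = b at *
  generalize pd j F x = f at *
  generalize pd l F x = g at *
  generalize pd j v x = p at *
  generalize pd l v x = q at *
  generalize pd j (pd l T) x = t at *
  generalize F x = c at *
  generalize x j - x l = d at *
  have e4 : f * g = a * b - 4 * c * p * q + 2 * c * d ^ 2 * t := by linarith
  have e5 : (a ^ 2 - 4 * c * p ^ 2) * (b ^ 2 - 4 * c * q ^ 2)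
      = (a * b - 4 * c * p * q + 2 * c * d ^ 2 * t) ^ 2 := by
    rw [← e4, e1, e2]; ring
  apply mul_left_cancel₀ hF0
  linear_combination (-4) * e5
end
end

section
/- (Appendix, equation (FF) from the Toda–AKNS system.) Let n be a real constant and U, W : Ω → ℝ be C² functions with U and W nonvanishing on Ω, satisfying at every point of Ω the equations 𝓑_{−1}²U = (−2𝓑_0 + 4n)U − 8U²W and 𝓑_{−1}²W = (2𝓑_0 + 4n)W − 8UW². Define F = UW, G = W 𝓑_{−1}U − U 𝓑_{−1}W, and G_0 = W 𝓑_0 U − U 𝓑_0 W. Then at every point of Ω: 𝓑_{−1}²F − ((𝓑_{−1}F)² − G²)/(2F) = −2G_0 − 16 F (F − n/2). -/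
noncomputable section

theorem Bop_neg_one_eq {N : ℕ} (f : (Fin N → ℝ) → ℝ) (x : Fin N → ℝ) :
    Bop (-1) f x = ∑ j, fderiv ℝ f x (Pi.single j 1) := by
  simp [Bop, pd]

theorem Bop_mul {N : ℕ} (f g : (Fin N → ℝ) → ℝ) (x : Fin N → ℝ)
    (hf : DifferentiableAt ℝ f x) (hg : DifferentiableAt ℝ g x) :
    Bop (-1) (fun y => f y * g y) x = f x * Bop (-1) g x + g x * Bop (-1) f x := by
  simp only [Bop_neg_one_eq]
  rw [fderiv_fun_mul hf hg, Finset.mul_sum, Finset.mul_sum, ← Finset.sum_add_distrib]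
  simp

theorem Bop_add {N : ℕ} (f g : (Fin N → ℝ) → ℝ) (x : Fin N → ℝ)
    (hf : DifferentiableAt ℝ f x) (hg : DifferentiableAt ℝ g x) :
    Bop (-1) (fun y => f y + g y) x = Bop (-1) f x + Bop (-1) g x := by
  simp only [Bop_neg_one_eq]
  rw [fderiv_fun_add hf hg, ← Finset.sum_add_distrib]
  simp

theorem Bop_diff {N : ℕ} (f : (Fin N → ℝ) → ℝ) (x : Fin N → ℝ)
    (hf : ContDiffAt ℝ 2 f x) : DifferentiableAt ℝ (Bop (-1) f) x := by
  have h : DifferentiableAt ℝ (fderiv ℝ f) x :=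
    (hf.fderiv_right (m := 1) (by norm_num)).differentiableAt (by norm_num)
  have e : Bop (-1) f = fun y => ∑ j, fderiv ℝ f y (Pi.single j 1) :=
    funext (Bop_neg_one_eq f)
  rw [e]
  fun_prop

theorem statement19 {N : ℕ} (hN : 1 ≤ N) (Ω : Set (Fin N → ℝ)) (hΩ : IsOpen Ω)
    (n : ℝ) (U W : (Fin N → ℝ) → ℝ)
    (hU : ContDiffOn ℝ 2 U Ω) (hW : ContDiffOn ℝ 2 W Ω)
    (hUne : ∀ x ∈ Ω, U x ≠ 0) (hWne : ∀ x ∈ Ω, W x ≠ 0)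
    (heqU : ∀ x ∈ Ω,
      Bop (-1) (Bop (-1) U) x = -2 * Bop 0 U x + 4 * n * U x - 8 * (U x) ^ 2 * W x)
    (heqW : ∀ x ∈ Ω,
      Bop (-1) (Bop (-1) W) x = 2 * Bop 0 W x + 4 * n * W x - 8 * U x * (W x) ^ 2)
    (F G G0 : (Fin N → ℝ) → ℝ)
    (hF : ∀ x, F x = U x * W x)
    (hG : ∀ x, G x = W x * Bop (-1) U x - U x * Bop (-1) W x)
    (hG0 : ∀ x, G0 x = W x * Bop 0 U x - U x * Bop 0 W x) :
    ∀ x ∈ Ω,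
      Bop (-1) (Bop (-1) F) x - ((Bop (-1) F x) ^ 2 - (G x) ^ 2) / (2 * F x)
        = -2 * G0 x - 16 * F x * (F x - n / 2) := by
  intro x hx
  have hFe : F = fun y => U y * W y := funext hF
  have cU : ∀ y ∈ Ω, ContDiffAt ℝ 2 U y := fun y hy => hU.contDiffAt (hΩ.mem_nhds hy)
  have cW : ∀ y ∈ Ω, ContDiffAt ℝ 2 W y := fun y hy => hW.contDiffAt (hΩ.mem_nhds hy)
  have dU : ∀ y ∈ Ω, DifferentiableAt ℝ U y := fun y hy => (cU y hy).differentiableAt (by norm_num)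
  have dW : ∀ y ∈ Ω, DifferentiableAt ℝ W y := fun y hy => (cW y hy).differentiableAt (by norm_num)
  have h1 : ∀ y ∈ Ω, Bop (-1) F y = U y * Bop (-1) W y + W y * Bop (-1) U y := by
    intro y hy
    rw [hFe]
    exact Bop_mul U W y (dU y hy) (dW y hy)
  have bU := Bop_diff U x (cU x hx)
  have bW := Bop_diff W x (cW x hx)
  have h2 : Bop (-1) (Bop (-1) F) x
      = Bop (-1) (fun y => U y * Bop (-1) W y + W y * Bop (-1) U y) x := by
    have ev : Bop (-1) F =ᶠ[nhds x] fun y => U y * Bop (-1) W y + W y * Bop (-1) U y :=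
      Filter.eventually_of_mem (hΩ.mem_nhds hx) h1
    rw [Bop_neg_one_eq, Bop_neg_one_eq, ev.fderiv_eq]
  rw [Bop_add _ _ x ((dU x hx).fun_mul bW) ((dW x hx).fun_mul bU), Bop_mul _ _ x (dU x hx) bW,
    Bop_mul _ _ x (dW x hx) bU, heqU x hx, heqW x hx] at h2
  rw [h2, h1 x hx, hG, hG0, hF]
  have := hUne x hx
  have := hWne x hx
  field_simp
  ring
end
end
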